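/- Let a = (a_1,...,a_d) be positive reals with a_1 + ... + a_d = d, and let λ, η > 0 satisfy (λ+η)/a_k ∈ (0,1) for all k. If q is a finite Borel measure on ℝ^d and A > 0 is such that for every bounded function φ : ℝ^d → ℝ with finite anisotropic Hölder norm ‖φ‖_{C_b^{η,a}} and every k ∈ {1,...,d} and h ∈ [-1,1] one has |∫ (φ(x + h e_k) - φ(x)) q(dx)| ≤ A ‖φ‖_{C_b^{η,a}} |h|^{(λ+η)/a_k}, then q is absolutely continuous with respect to Lebesgue measure. -/

import Mathlib

open MeasureTheory Finset

/-- The anisotropic Hölder–Zygmund norm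
`‖φ‖_{C_b^{η,a}} = sup |φ| + ∑_k sup_{h ∈ [-1,1]} |h|^{-η/a_k} sup_x |φ(x + h e_k) − φ(x)|`. -/
noncomputable def holderNorm (d : ℕ) (η : ℝ) (a : Fin d → ℝ)
    (φ : (Fin d → ℝ) → ℝ) : ℝ :=
  (⨆ x, |φ x|) +
    ∑ k : Fin d, ⨆ h : Set.Icc (-1 : ℝ) 1,
      |h.1| ^ (-(η / a k)) * ⨆ x, |φ (x + h.1 • (Pi.single k 1 : Fin d → ℝ)) - φ x|

open Filter Topology

namespace AnisoAC

/-- anisotropic dilation -/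
noncomputable def dil {d : ℕ} (a : Fin d → ℝ) (t : ℝ) (y : Fin d → ℝ) : Fin d → ℝ :=
  fun k => t ^ a k * y k

/-- anisotropic averaging -/
noncomputable def avg {d : ℕ} (a : Fin d → ℝ) (t : ℝ) (φ : (Fin d → ℝ) → ℝ)
    (x : Fin d → ℝ) : ℝ :=
  ∫ y in Set.Icc (0 : Fin d → ℝ) 1, φ (x + dil a t y)

lemma dil_continuous {d : ℕ} (a : Fin d → ℝ) (t : ℝ) : Continuous (dil a t) := by
  unfold dil; fun_prop

lemma vol_cube (d : ℕ) : volume (Set.Icc (0 : Fin d → ℝ) 1) = 1 := by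
  simp [Real.volume_Icc_pi]

instance cube_prob (d : ℕ) :
    IsProbabilityMeasure ((volume : Measure (Fin d → ℝ)).restrict (Set.Icc 0 1)) :=
  ⟨by simp [vol_cube]⟩

lemma integrable_bdd {X : Type*} [TopologicalSpace X] [MeasurableSpace X] [BorelSpace X]
    (μ : Measure X) [IsFiniteMeasure μ] {f : X → ℝ} (hf : Continuous f) {M : ℝ}
    (hM : ∀ x, |f x| ≤ M) : Integrable f μ :=
  Integrable.of_bound hf.measurable.aestronglyMeasurable M (ae_of_all _ hM)

lemma avg_continuous {d : ℕ} (a : Fin d → ℝ) (t : ℝ) {φ : (Fin d → ℝ) → ℝ}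
    (hφ : Continuous φ) : Continuous (avg a t φ) := by
  unfold avg
  apply continuous_parametric_integral_of_continuous _ isCompact_Icc
  have := dil_continuous a t
  simp only [Function.uncurry_def]
  fun_prop

lemma avg_bound {d : ℕ} (a : Fin d → ℝ) (t : ℝ) {φ : (Fin d → ℝ) → ℝ} {M : ℝ}
    (hM : ∀ x, |φ x| ≤ M) (x : Fin d → ℝ) : |avg a t φ x| ≤ M := by
  have := norm_integral_le_of_norm_le_const
    (μ := (volume : Measure (Fin d → ℝ)).restrict (Set.Icc 0 1))
    (f := fun y => φ (x + dil a t y)) (C := M) (ae_of_all _ fun y => hM _)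
  simpa [avg] using this

lemma vol_shift {d : ℕ} (k : Fin d) (u : ℝ) (hu : |u| ≤ 1) :
    1 - |u| ≤ (volume : Measure (Fin d → ℝ)).real
      (Set.Icc (0 : Fin d → ℝ) 1 ∩ Set.Icc (Pi.single k u) (1 + Pi.single k u)) := by
  rw [Set.Icc_inter_Icc, Measure.real, Real.volume_Icc_pi, ENNReal.toReal_prod]
  rw [← Finset.mul_prod_erase _ _ (Finset.mem_univ k), Finset.prod_eq_one]
  · rw [mul_one]
    rw [ENNReal.toReal_ofReal']
    refine le_trans ?_ (le_max_left _ _)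
    simp only [Pi.inf_apply, Pi.sup_apply, Pi.one_apply, Pi.zero_apply, Pi.add_apply,
      Pi.single_eq_same]
    rcases le_total 0 u with h | h
    · rw [abs_of_nonneg h]; simp [h]
    · rw [abs_of_nonpos h]; simp [h]
  · intro i hi
    have : i ≠ k := (Finset.mem_erase.1 hi).1
    simp [this]

lemma shift_est {d : ℕ} (k : Fin d) (u : ℝ) {f : (Fin d → ℝ) → ℝ} (hf : Continuous f) {M : ℝ}
    (hM : ∀ x, |f x| ≤ M) (hu : |u| ≤ 1) :
    |(∫ y in Set.Icc (0 : Fin d → ℝ) 1, f (y + Pi.single k u))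
      - ∫ y in Set.Icc (0 : Fin d → ℝ) 1, f y| ≤ 2 * M * |u| := by
  have hM0 : 0 ≤ M := le_trans (abs_nonneg _) (hM 0)
  set Q := Set.Icc (0 : Fin d → ℝ) 1
  set R := Set.Icc (Pi.single k u : Fin d → ℝ) (1 + Pi.single k u)
  have e1 : (∫ y in Q, f (y + Pi.single k u)) = ∫ y in R, f y := by
    have mp := measurePreserving_add_right (volume : Measure (Fin d → ℝ)) (Pi.single k u)
    have := mp.setIntegral_preimage_emb (measurableEmbedding_addRight _) f R
    rw [← this]
    congr 2
    simp [R, Q]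
  have hQ : volume Q = 1 := vol_cube d
  have hR : volume R = 1 := by
    simp [R, Real.volume_Icc_pi]
  have mQ : MeasurableSet Q := measurableSet_Icc
  have mR : MeasurableSet R := measurableSet_Icc
  have iQ : IntegrableOn f Q := hf.continuousOn.integrableOn_compact isCompact_Icc
  have iR : IntegrableOn f R := hf.continuousOn.integrableOn_compact isCompact_Icc
  have d1 := integral_inter_add_sdiff (μ := volume) (f := f) (s := Q) mR iQ
  have d2 := integral_inter_add_sdiff (μ := volume) (f := f) (s := R) mQ iR
  have v := vol_shift k u hu
  have v1 := measureReal_inter_add_sdiff (μ := volume) (s := Q) mR (by simp [hQ])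
  have v2 := measureReal_inter_add_sdiff (μ := volume) (s := R) mQ (by simp [hR])
  have hQ' : (volume : Measure (Fin d → ℝ)).real Q = 1 := by simp [Measure.real, hQ]
  have hR' : (volume : Measure (Fin d → ℝ)).real R = 1 := by simp [Measure.real, hR]
  change 1 - |u| ≤ (volume : Measure (Fin d → ℝ)).real (Q ∩ R) at v
  rw [Set.inter_comm R Q] at d2 v2
  have fQ : volume (Q \ R) < ⊤ :=
    lt_of_le_of_lt (measure_mono Set.sdiff_subset) (by rw [hQ]; exact ENNReal.one_lt_top)
  have fR : volume (R \ Q) < ⊤ :=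
    lt_of_le_of_lt (measure_mono Set.sdiff_subset) (by rw [hR]; exact ENNReal.one_lt_top)
  have b1 : |∫ y in Q \ R, f y| ≤ M * (volume : Measure (Fin d → ℝ)).real (Q \ R) :=
    norm_setIntegral_le_of_norm_le_const (f := f) fQ fun y _ => hM y
  have b2 : |∫ y in R \ Q, f y| ≤ M * (volume : Measure (Fin d → ℝ)).real (R \ Q) :=
    norm_setIntegral_le_of_norm_le_const (f := f) fR fun y _ => hM y
  have b3 : M * (volume : Measure (Fin d → ℝ)).real (Q \ R) ≤ M * |u| :=
    mul_le_mul_of_nonneg_left (by linarith) hM0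
  have b4 : M * (volume : Measure (Fin d → ℝ)).real (R \ Q) ≤ M * |u| :=
    mul_le_mul_of_nonneg_left (by linarith) hM0
  rw [e1, ← d1, ← d2]
  rw [abs_le] at *
  constructor <;> linarith

lemma avg_shift {d : ℕ} (a : Fin d → ℝ) {t : ℝ} (ht : 0 < t) (k : Fin d) (h : ℝ) {β : ℝ}
    (hβ0 : 0 ≤ β) (hβ : β ≤ 1)
    {φ : (Fin d → ℝ) → ℝ} (hφ : Continuous φ) {M : ℝ} (hM : ∀ x, |φ x| ≤ M)
    (x : Fin d → ℝ) :
    |avg a t φ (x + h • (Pi.single k 1 : Fin d → ℝ)) - avg a t φ x|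
      ≤ 2 * M * (|h| / t ^ a k) ^ β := by
  have hM0 : 0 ≤ M := le_trans (abs_nonneg _) (hM 0)
  have htk : 0 < t ^ a k := Real.rpow_pos_of_pos ht _
  have hu : |h / t ^ a k| = |h| / t ^ a k := by rw [abs_div, abs_of_pos htk]
  rcases le_total (|h| / t ^ a k) 1 with h1 | h1
  · have := shift_est k (h / t ^ a k) (f := fun y => φ (x + dil a t y)) (M := M)
      (by have := dil_continuous a t; fun_prop) (fun y => hM _) (by rwa [hu])
    rw [hu] at this
    have e : avg a t φ (x + h • (Pi.single k 1 : Fin d → ℝ))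
        = ∫ y in Set.Icc (0 : Fin d → ℝ) 1, φ (x + dil a t (y + Pi.single k (h / t ^ a k))) := by
      unfold avg
      congr 1
      ext y
      congr 1
      ext i
      by_cases hi : i = k
      · subst hi
        simp [dil]
        field_simp
        ring
      · simp [dil, hi]
    rw [e]
    refine this.trans (mul_le_mul_of_nonneg_left ?_ (by positivity))
    exact Real.self_le_rpow_of_le_one (by positivity) h1 hβ
  · have l1 := avg_bound a t hM (x + h • (Pi.single k 1 : Fin d → ℝ))
    have l2 := avg_bound a t hM x
    have l3 : 2 * M * 1 ≤ 2 * M * (|h| / t ^ a k) ^ β :=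
      mul_le_mul_of_nonneg_left (Real.one_le_rpow h1 hβ0) (by positivity)
    rw [abs_le] at *
    constructor <;> linarith

lemma avg_term {d : ℕ} (a : Fin d → ℝ) {t : ℝ} (ht : 0 < t) (k : Fin d) (hak : 0 < a k) {η : ℝ}
    (hη : 0 < η) (hη1 : η / a k ≤ 1) (h : ℝ)
    {φ : (Fin d → ℝ) → ℝ} (hφ : Continuous φ) {M : ℝ} (hM : ∀ x, |φ x| ≤ M) :
    |h| ^ (-(η / a k)) *
      ⨆ x, |avg a t φ (x + h • (Pi.single k 1 : Fin d → ℝ)) - avg a t φ x|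
      ≤ 2 * M * t ^ (-η) := by
  have hM0 : 0 ≤ M := le_trans (abs_nonneg _) (hM 0)
  have hs : (⨆ x, |avg a t φ (x + h • (Pi.single k 1 : Fin d → ℝ)) - avg a t φ x|)
      ≤ 2 * M * (|h| / t ^ a k) ^ (η / a k) :=
    ciSup_le fun x => avg_shift a ht k h (by positivity) hη1 hφ hM x
  have e : (|h| / t ^ a k) ^ (η / a k) = |h| ^ (η / a k) * t ^ (-η) := by
    rw [Real.div_rpow (abs_nonneg _) (by positivity), ← Real.rpow_mul ht.le,
      mul_div_cancel₀ _ hak.ne', Real.rpow_neg ht.le, div_eq_mul_inv]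
  have hc : |h| ^ (-(η / a k)) * |h| ^ (η / a k) ≤ 1 := by
    rw [Real.rpow_neg (abs_nonneg _)]
    exact inv_mul_le_one
  calc _ ≤ |h| ^ (-(η / a k)) * (2 * M * (|h| / t ^ a k) ^ (η / a k)) :=
        mul_le_mul_of_nonneg_left hs (by positivity)
    _ = (|h| ^ (-(η / a k)) * |h| ^ (η / a k)) * (2 * M * t ^ (-η)) := by rw [e]; ring
    _ ≤ 1 * (2 * M * t ^ (-η)) := mul_le_mul_of_nonneg_right hc (by positivity)
    _ = _ := one_mul _

lemma avg_norm {d : ℕ} (a : Fin d → ℝ) {t : ℝ} (ht : 0 < t) (ht1 : t ≤ 1) (ha : ∀ k, 0 < a k)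
    {η : ℝ} (hη : 0 < η) (hη1 : ∀ k, η / a k ≤ 1)
    {φ : (Fin d → ℝ) → ℝ} (hφ : Continuous φ) {M : ℝ} (hM : ∀ x, |φ x| ≤ M) :
    holderNorm d η a (avg a t φ) ≤ (1 + 2 * d) * M * t ^ (-η) := by
  have hM0 : 0 ≤ M := le_trans (abs_nonneg _) (hM 0)
  have h1 : (⨆ x, |avg a t φ x|) ≤ M := ciSup_le fun x => avg_bound a t hM x
  have h2 : (∑ k : Fin d, ⨆ h : Set.Icc (-1 : ℝ) 1,
      |h.1| ^ (-(η / a k)) *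
        ⨆ x, |avg a t φ (x + h.1 • (Pi.single k 1 : Fin d → ℝ)) - avg a t φ x|)
      ≤ ∑ k : Fin d, 2 * M * t ^ (-η) := by
    refine Finset.sum_le_sum fun k _ => ?_
    have : Nonempty (Set.Icc (-1 : ℝ) 1) := ⟨⟨0, by norm_num⟩⟩
    exact ciSup_le fun h => avg_term a ht k (ha k) hη (hη1 k) h.1 hφ hM
  have h3 : 1 ≤ t ^ (-η) := Real.one_le_rpow_of_pos_of_le_one_of_nonpos ht ht1 (by linarith)
  have h4 : M * 1 ≤ M * t ^ (-η) := mul_le_mul_of_nonneg_left h3 hM0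
  simp only [Finset.sum_const, Finset.card_univ, Fintype.card_fin, nsmul_eq_mul] at h2
  unfold holderNorm
  linarith

lemma avg_comm {d : ℕ} (a : Fin d → ℝ) (s t : ℝ)
    {φ : (Fin d → ℝ) → ℝ} (hφ : Continuous φ) {M : ℝ} (hM : ∀ x, |φ x| ≤ M)
    (x : Fin d → ℝ) : avg a s (avg a t φ) x = avg a t (avg a s φ) x := by
  unfold avg
  rw [integral_integral_swap]
  · simp only [add_right_comm]
  · refine integrable_bdd _ (M := M) ?_ ?_
    · have := dil_continuous a t
      have := dil_continuous a s
      simp only [Function.uncurry_def]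
      fun_prop
    · intro y; exact hM _

/-- core estimate for averaging against `q` -/
lemma avg_diff {d : ℕ} (a : Fin d → ℝ) (s B : ℝ) (q : Measure (Fin d → ℝ)) [IsFiniteMeasure q]
    {ψ : (Fin d → ℝ) → ℝ} (hψ : Continuous ψ) {M : ℝ} (hM : ∀ x, |ψ x| ≤ M)
    (hB : ∀ y ∈ Set.Icc (0 : Fin d → ℝ) 1, |∫ x, (ψ (x + dil a s y) - ψ x) ∂q| ≤ B) :
    |(∫ x, avg a s ψ x ∂q) - ∫ x, ψ x ∂q| ≤ B := by
  have c := dil_continuous a s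
  have e : (∫ x, avg a s ψ x ∂q) - ∫ x, ψ x ∂q
      = ∫ y in Set.Icc (0 : Fin d → ℝ) 1, (∫ x, (ψ (x + dil a s y) - ψ x) ∂q) := by
    rw [← integral_sub (integrable_bdd q (avg_continuous a s hψ) (avg_bound a s hM))
      (integrable_bdd q hψ hM)]
    rw [← integral_integral_swap]
    · congr 1
      ext x
      rw [integral_sub]
      · simp [avg]
      · exact integrable_bdd _ (by fun_prop) (fun y => hM _)
      · exact integrable_const _
    · refine integrable_bdd _ (M := M + M) ?_ ?_
      · simp only [Function.uncurry_def]
        fun_prop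
      · intro y
        exact (abs_sub _ _).trans (add_le_add (hM _) (hM _))
  rw [e]
  have := norm_setIntegral_le_of_norm_le_const (μ := volume) (C := B)
    (s := Set.Icc (0 : Fin d → ℝ) 1)
    (f := fun y => ∫ x, (ψ (x + dil a s y) - ψ x) ∂q) (by simp [vol_cube]) hB
  simpa [Measure.real, vol_cube] using this

lemma avg_translate {d : ℕ} (a : Fin d → ℝ) (t : ℝ) (φ : (Fin d → ℝ) → ℝ) (w x : Fin d → ℝ) :
    avg a t (fun z => φ (z + w)) x = avg a t φ (x + w) := by
  unfold avg
  simp only [add_right_comm]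

lemma avg_tendsto {d : ℕ} (a : Fin d → ℝ) (ha : ∀ k, 0 < a k)
    {φ : (Fin d → ℝ) → ℝ} (hφ : Continuous φ) {M : ℝ} (hM : ∀ x, |φ x| ≤ M)
    (x : Fin d → ℝ) :
    Tendsto (fun n : ℕ => avg a ((1 / 2 : ℝ) ^ n) φ x) atTop (𝓝 (φ x)) := by
  have : φ x = ∫ y in Set.Icc (0 : Fin d → ℝ) 1, φ x := by simp
  rw [this]
  unfold avg
  apply tendsto_integral_of_dominated_convergence (fun _ => M)
  · intro n
    have := dil_continuous a ((1 / 2 : ℝ) ^ n)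
    exact Continuous.aestronglyMeasurable (by fun_prop)
  · exact integrable_const _
  · intro n; exact ae_of_all _ fun y => hM _
  · refine ae_of_all _ fun y => ?_
    have h0 : Tendsto (fun n : ℕ => (1 / 2 : ℝ) ^ n) atTop (𝓝 0) :=
      tendsto_pow_atTop_nhds_zero_of_lt_one (by norm_num) (by norm_num)
    have h1 : Tendsto (fun n : ℕ => x + dil a ((1 / 2 : ℝ) ^ n) y) atTop (𝓝 x) := by
      rw [tendsto_pi_nhds]
      intro k
      have h2 := (h0.rpow_const (p := a k) (Or.inr (ha k).le)).mul_const (y k)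
      rw [Real.zero_rpow (ha k).ne', zero_mul] at h2
      simpa [dil] using h2.const_add (x k)
    exact (hφ.tendsto x).comp h1

end AnisoAC

open AnisoAC

/-- anisotropic integration by parts implies absolute continuity.
If `a` is an anisotropy, `λ, η > 0` with `(λ+η)/a k ∈ (0,1)`, `q` a finite measure on
`ℝ^d`, and for every bounded continuous `φ` with finite anisotropic Hölder norm one has
`|∫ (φ(x + h e_k) − φ(x)) dq| ≤ A ‖φ‖_{C_b^{η,a}} |h|^{(λ+η)/a_k}` for all `k` and
`h ∈ [-1,1]`, then `q` is absolutely continuous with respect to Lebesgue measure. -/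
theorem stmt_0 (d : ℕ) (a : Fin d → ℝ) (ha_pos : ∀ k, 0 < a k)
    (ha_sum : ∑ k, a k = d) (lam η : ℝ) (hlam : 0 < lam) (hη : 0 < η)
    (hexp : ∀ k, (lam + η) / a k ∈ Set.Ioo (0 : ℝ) 1)
    (q : Measure (Fin d → ℝ)) [IsFiniteMeasure q] (A : ℝ) (hA : 0 < A)
    (hq : ∀ φ : (Fin d → ℝ) → ℝ, Continuous φ → (∃ M, ∀ x, |φ x| ≤ M) →
      (∀ k : Fin d, BddAbove (Set.range fun h : Set.Icc (-1 : ℝ) 1 =>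
        |h.1| ^ (-(η / a k)) * ⨆ x, |φ (x + h.1 • (Pi.single k 1 : Fin d → ℝ)) - φ x|)) →
      ∀ k : Fin d, ∀ h ∈ Set.Icc (-1 : ℝ) 1,
        |∫ x, (φ (x + h • (Pi.single k 1 : Fin d → ℝ)) - φ x) ∂q|
          ≤ A * holderNorm d η a φ * |h| ^ ((lam + η) / a k)) :
    q ≪ (volume : Measure (Fin d → ℝ)) := by
  classical
  have hη1 : ∀ k, η / a k ≤ 1 := fun k =>
    (div_le_div_of_nonneg_right (by linarith) (ha_pos k).le).trans (hexp k).2.le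
  set C : ℝ := A * (1 + 2 * d) with hC
  have hC0 : 0 ≤ C := by positivity
  -- single direction
  have key : ∀ t : ℝ, 0 < t → t ≤ 1 → ∀ s : ℝ, 0 < s → s ≤ 1 →
      ∀ φ : (Fin d → ℝ) → ℝ, Continuous φ → (∀ x, |φ x| ≤ 1) →
      ∀ k : Fin d, ∀ h : ℝ, |h| ≤ s ^ a k →
      |∫ x, (avg a t φ (x + h • (Pi.single k 1 : Fin d → ℝ)) - avg a t φ x) ∂q|
        ≤ C * (t ^ (-η) * s ^ (lam + η)) := by
    intro t ht ht1 s hs hs1 φ hφ hM k h hh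
    have h1 : |h| ≤ 1 := hh.trans (Real.rpow_le_one hs.le hs1 (ha_pos k).le)
    have := hq (avg a t φ) (avg_continuous a t hφ) ⟨1, avg_bound a t hM⟩ (by
      intro k
      refine ⟨2 * 1 * t ^ (-η), ?_⟩
      rintro _ ⟨h, rfl⟩
      exact avg_term a ht k (ha_pos k) hη (hη1 k) h.1 hφ hM) k h (abs_le.1 h1)
    refine this.trans ?_
    have n1 := avg_norm a ht ht1 ha_pos hη hη1 hφ hM
    have n2 : |h| ^ ((lam + η) / a k) ≤ s ^ (lam + η) := by
      refine (Real.rpow_le_rpow (abs_nonneg _) hh (hexp k).1.le).trans ?_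
      rw [← Real.rpow_mul hs.le, mul_div_cancel₀ _ (ha_pos k).ne']
    calc A * holderNorm d η a (avg a t φ) * |h| ^ ((lam + η) / a k)
        ≤ A * ((1 + 2 * d) * 1 * t ^ (-η)) * s ^ (lam + η) := by gcongr
      _ = _ := by rw [hC]; ring
  -- all directions
  have key2 : ∀ t : ℝ, 0 < t → t ≤ 1 → ∀ s : ℝ, 0 < s → s ≤ 1 →
      ∀ φ : (Fin d → ℝ) → ℝ, Continuous φ → (∀ x, |φ x| ≤ 1) →
      ∀ v : Fin d → ℝ, (∀ k, |v k| ≤ s ^ a k) → ∀ S : Finset (Fin d),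
      |∫ x, (avg a t φ (x + ∑ k ∈ S, v k • (Pi.single k 1 : Fin d → ℝ)) - avg a t φ x) ∂q|
        ≤ S.card * (C * (t ^ (-η) * s ^ (lam + η))) := by
    intro t ht ht1 s hs hs1 φ hφ hM v hv S
    induction S using Finset.induction_on with
    | empty => simp
    | insert k S hk ih =>
      set w := ∑ k ∈ S, v k • (Pi.single k 1 : Fin d → ℝ) with hw
      have k1 := key t ht ht1 s hs hs1 (fun z => φ (z + w)) (by fun_prop) (fun x => hM _) k (v k)
        (hv k)
      simp only [avg_translate] at k1
      rw [Finset.sum_insert hk, Finset.card_insert_of_notMem hk, ← hw]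
      have hc := avg_continuous a t hφ
      have hb := avg_bound a t hM
      have e : ∫ x, (avg a t φ (x + (v k • (Pi.single k 1 : Fin d → ℝ) + w)) - avg a t φ x) ∂q
          = (∫ x, (avg a t φ (x + v k • (Pi.single k 1 : Fin d → ℝ) + w)
              - avg a t φ (x + w)) ∂q) + ∫ x, (avg a t φ (x + w) - avg a t φ x) ∂q := by
        rw [← integral_add]
        · simp [add_assoc]
        · exact (integrable_bdd q (by fun_prop) (fun x => hb _)).sub
            (integrable_bdd q (by fun_prop) (fun x => hb _))
        · exact (integrable_bdd q (by fun_prop) (fun x => hb _)).sub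
            (integrable_bdd q (by fun_prop) (fun x => hb _))
      rw [e]
      refine (abs_add_le _ _).trans ?_
      push_cast
      linarith
  have key3 : ∀ t : ℝ, 0 < t → t ≤ 1 → ∀ s : ℝ, 0 < s → s ≤ 1 →
      ∀ φ : (Fin d → ℝ) → ℝ, Continuous φ → (∀ x, |φ x| ≤ 1) →
      |(∫ x, avg a s (avg a t φ) x ∂q) - ∫ x, avg a t φ x ∂q|
        ≤ d * C * (t ^ (-η) * s ^ (lam + η)) := by
    intro t ht ht1 s hs hs1 φ hφ hM
    refine avg_diff a s _ q (avg_continuous a t hφ) (avg_bound a t hM) fun y hy => ?_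
    have := key2 t ht ht1 s hs hs1 φ hφ hM (dil a s y) (by
      intro k
      have h0 := hy.1 k
      have h1 := hy.2 k
      simp only [Pi.zero_apply, Pi.one_apply] at h0 h1
      have hp : 0 < s ^ a k := Real.rpow_pos_of_pos hs _
      rw [dil, abs_of_nonneg (by positivity)]
      exact mul_le_of_le_one_right hp.le h1) Finset.univ
    have e : ∑ k, dil a s y k • (Pi.single k 1 : Fin d → ℝ) = dil a s y := by
      ext i
      simp [Finset.sum_apply, Pi.single_apply]
    rw [e] at this
    simpa [mul_assoc] using this
  -- geometric decay
  set r : ℝ := (1 / 2 : ℝ) ^ lam with hr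
  have hr0 : 0 ≤ r := by positivity
  have hr1 : r < 1 := Real.rpow_lt_one (by norm_num) (by norm_num) hlam
  set K0 : ℝ := d * C * (1 + 2 ^ η) with hK0
  have key4 : ∀ φ : (Fin d → ℝ) → ℝ, Continuous φ → (∀ x, |φ x| ≤ 1) → ∀ n : ℕ,
      |(∫ x, avg a ((1 / 2 : ℝ) ^ n) φ x ∂q) - ∫ x, φ x ∂q| ≤ K0 * r ^ n / (1 - r) := by
    intro φ hφ hM n
    have hstep : ∀ n : ℕ, dist (∫ x, avg a ((1 / 2 : ℝ) ^ n) φ x ∂q)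
        (∫ x, avg a ((1 / 2 : ℝ) ^ (n + 1)) φ x ∂q) ≤ K0 * r ^ n := by
      intro n
      set t : ℝ := (1 / 2 : ℝ) ^ n with htdef
      have ht : 0 < t := by positivity
      have ht1 : t ≤ 1 := pow_le_one₀ (by norm_num) (by norm_num)
      have hs : (1 / 2 : ℝ) ^ (n + 1) = t / 2 := by rw [pow_succ]; ring
      rw [hs]
      have b1 := key3 t ht ht1 (t / 2) (by positivity) (by linarith) φ hφ hM
      have b2 := key3 (t / 2) (by positivity) (by linarith) t ht ht1 φ hφ hM
      have ec : (∫ x, avg a t (avg a (t / 2) φ) x ∂q) = ∫ x, avg a (t / 2) (avg a t φ) x ∂q := by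
        congr 1
        ext x
        exact avg_comm a _ _ hφ hM x
      rw [ec] at b2
      have htr : t ^ lam = r ^ n := by
        rw [htdef, hr, ← Real.rpow_natCast, ← Real.rpow_natCast, ← Real.rpow_mul (by norm_num),
          ← Real.rpow_mul (by norm_num), mul_comm]
      have e1 : t ^ (-η) * t ^ (lam + η) = t ^ lam := by
        rw [← Real.rpow_add ht]; congr 1; ring
      have e2 : (t / 2) ^ (-η) = 2 ^ η * t ^ (-η) := by
        rw [Real.div_rpow ht.le (by norm_num), Real.rpow_neg (by norm_num : (0:ℝ) ≤ 2), div_inv_eq_mul, mul_comm]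
      have c1 : d * C * (t ^ (-η) * (t / 2) ^ (lam + η)) ≤ d * C * r ^ n := by
        rw [← htr, ← e1]
        gcongr
        linarith
      have c2 : d * C * ((t / 2) ^ (-η) * t ^ (lam + η)) = d * C * 2 ^ η * r ^ n := by
        rw [e2, mul_assoc (2 ^ η), e1, htr]; ring
      have c3 : K0 * r ^ n = d * C * r ^ n + d * C * 2 ^ η * r ^ n := by rw [hK0]; ring
      rw [Real.dist_eq, c3]
      rw [abs_le] at *
      constructor <;> linarith
    have hlim : Tendsto (fun n : ℕ => ∫ x, avg a ((1 / 2 : ℝ) ^ n) φ x ∂q) atTop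
        (𝓝 (∫ x, φ x ∂q)) := by
      apply tendsto_integral_of_dominated_convergence (fun _ => (1 : ℝ))
      · intro n
        exact (avg_continuous a _ hφ).aestronglyMeasurable
      · exact integrable_const _
      · intro n; exact ae_of_all _ fun y => avg_bound a _ hM y
      · exact ae_of_all _ fun x => avg_tendsto a ha_pos hφ hM x
    exact dist_le_of_le_geometric_of_tendsto r K0 hr1 hstep hlim n
  -- compact null sets
  have hcomp : ∀ K : Set (Fin d → ℝ), IsCompact K → volume K = 0 → q K = 0 := by
    intro K hK hK0'
    set δ : ℕ → ℝ := fun j => 1 / ((j : ℝ) + 1) with hδ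
    have δpos : ∀ j, 0 < δ j := fun j => by positivity
    have δlim : Tendsto δ atTop (𝓝 0) := tendsto_one_div_add_atTop_nhds_zero_nat
    set f : ℕ → (Fin d → ℝ) → ℝ := fun j x => (thickenedIndicator (δpos j) K x : ℝ) with hf
    have fc : ∀ j, Continuous (f j) := fun j =>
      NNReal.continuous_coe.comp (thickenedIndicator (δpos j) K).continuous
    have fb : ∀ j x, |f j x| ≤ 1 := fun j x => by
      rw [hf, abs_of_nonneg (NNReal.coe_nonneg _)]
      exact_mod_cast thickenedIndicator_le_one (δpos j) K x
    have flim : ∀ x, Tendsto (fun j => f j x) atTop (𝓝 (K.indicator (fun _ => (1 : ℝ)) x)) := by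
      intro x
      have := thickenedIndicator_tendsto_indicator_closure δpos δlim K
      rw [tendsto_pi_nhds] at this
      have h1 := (NNReal.continuous_coe.tendsto _).comp (this x)
      rw [hK.isClosed.closure_eq] at h1
      have e : K.indicator (fun _ => (1 : ℝ)) x = ((K.indicator (fun _ => 1) x : NNReal) : ℝ) := by
        by_cases hx : x ∈ K <;> simp [hx]
      rw [e]
      exact h1
    have qlim : Tendsto (fun j => ∫ x, f j x ∂q) atTop (𝓝 (q.real K)) := by
      have : q.real K = ∫ x, K.indicator (fun _ => (1 : ℝ)) x ∂q := by
        rw [integral_indicator hK.measurableSet]; simp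
      rw [this]
      apply tendsto_integral_of_dominated_convergence (fun _ => (1 : ℝ))
      · intro j; exact (fc j).aestronglyMeasurable
      · exact integrable_const _
      · intro j; exact ae_of_all _ fun y => fb j y
      · exact ae_of_all _ flim
    have alim : ∀ t : ℝ, 0 < t → ∀ x, Tendsto (fun j => avg a t (f j) x) atTop (𝓝 0) := by
      intro t ht x
      have hnull : ∀ᵐ y ∂(volume : Measure (Fin d → ℝ)), x + dil a t y ∉ K := by
        have hdet : (Matrix.diagonal fun k => t ^ a k).det ≠ 0 := by
          rw [Matrix.det_diagonal]
          exact (Finset.prod_pos fun k _ => Real.rpow_pos_of_pos ht _).ne'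
        have hp : volume ((Matrix.toLin' (Matrix.diagonal fun k => t ^ a k)) ⁻¹'
            ((fun z => x + z) ⁻¹' K)) = 0 := by
          rw [Measure.addHaar_preimage_linearMap _ (by rwa [LinearMap.det_toLin'])]
          rw [measure_preimage_add, hK0', mul_zero]
        rw [ae_iff]
        convert hp using 2
        ext y
        have : dil a t y = Matrix.mulVec (Matrix.diagonal fun k => t ^ a k) y := by
          ext i; simp [dil, Matrix.mulVec_diagonal]
        simp [this]
      have : (0 : ℝ) = ∫ y in Set.Icc (0 : Fin d → ℝ) 1, (0 : ℝ) := by simp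
      rw [this]
      unfold avg
      apply tendsto_integral_of_dominated_convergence (fun _ => (1 : ℝ))
      · intro j
        have := dil_continuous a t
        have := fc j
        exact Continuous.aestronglyMeasurable (by fun_prop)
      · exact integrable_const _
      · intro j; exact ae_of_all _ fun y => fb j _
      · filter_upwards [ae_restrict_of_ae hnull] with y hy
        have := flim (x + dil a t y)
        rwa [Set.indicator_of_notMem hy] at this
    have qalim : ∀ t : ℝ, 0 < t → Tendsto (fun j => ∫ x, avg a t (f j) x ∂q) atTop (𝓝 0) := by
      intro t ht
      have : (0 : ℝ) = ∫ x, (0 : ℝ) ∂q := by simp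
      rw [this]
      apply tendsto_integral_of_dominated_convergence (fun _ => (1 : ℝ))
      · intro j; exact (avg_continuous a t (fc j)).aestronglyMeasurable
      · exact integrable_const _
      · intro j; exact ae_of_all _ fun y => avg_bound a t (fb j) y
      · exact ae_of_all _ fun x => alim t ht x
    have hle : ∀ n : ℕ, q.real K ≤ K0 * r ^ n / (1 - r) := by
      intro n
      have h1 := ((qalim ((1 / 2 : ℝ) ^ n) (by positivity)).sub qlim).abs
      have h2 := le_of_tendsto h1 (Eventually.of_forall fun j => key4 (f j) (fc j) (fb j) n)
      rw [zero_sub, abs_neg, abs_of_nonneg measureReal_nonneg] at h2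
      exact h2
    have hlim0 : Tendsto (fun n : ℕ => K0 * r ^ n / (1 - r)) atTop (𝓝 0) := by
      have := ((tendsto_pow_atTop_nhds_zero_of_lt_one hr0 hr1).const_mul K0).div_const (1 - r)
      simpa using this
    have h0 : q.real K ≤ 0 := ge_of_tendsto hlim0 (Eventually.of_forall hle)
    have h0' : q.real K = 0 := le_antisymm h0 measureReal_nonneg
    exact (measureReal_eq_zero_iff).1 h0'
  refine Measure.AbsolutelyContinuous.mk fun s hs hs0 => ?_
  rw [hs.measure_eq_iSup_isCompact]
  simp only [ENNReal.iSup_eq_zero]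
  intro K hKs hK
  exact hcomp K hK (measure_mono_null hKs hs0)
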